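/- Let μ ∈ M with associated matrix W. If μ is an extreme point of M, then w_{ij} ∈ {−1, 0, 1} for every edge {θ_i, θ_j} of G. -/

import Mathlib

noncomputable section

open Finset

/-- `μ` is a probability distribution on the finite type `V`. -/
def IsDist {V : Type*} [Fintype V] (μ : V → ℝ) : Prop :=
  (∀ v, 0 ≤ μ v) ∧ ∑ v, μ v = 1

/-- The feasible posterior set `M` for the graph-based inferential privacy constraint:
distributions `μ` with `μ(θᵢ)·μ₀(θⱼ) ≤ e^ε·μ(θⱼ)·μ₀(θᵢ)` for every edge of `G`. -/
def FeasibleSet {V : Type*} [Fintype V] (G : SimpleGraph V) (ε : ℝ) (μ0 : V → ℝ) :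
    Set (V → ℝ) :=
  {μ | IsDist μ ∧ ∀ i j : V, G.Adj i j → μ i * μ0 j ≤ Real.exp ε * (μ j * μ0 i)}

/-- The matrix `W` associated to a posterior `μ` (relative to the prior `μ0`):
`w_{ij} = (ln μ(θⱼ) − ln μ₀(θⱼ) − ln μ(θᵢ) + ln μ₀(θᵢ)) / ε`. -/
def assocW {V : Type*} (ε : ℝ) (μ0 μ : V → ℝ) (i j : V) : ℝ :=
  (Real.log (μ j) - Real.log (μ0 j) - Real.log (μ i) + Real.log (μ0 i)) / ε

/-- `μ` is an extreme point of `M`: it lies in `M` and cannot be written as a proper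
convex combination of two distinct elements of `M`. -/
def IsExtremePt {V : Type*} (M : Set (V → ℝ)) (μ : V → ℝ) : Prop :=
  μ ∈ M ∧ ¬ ∃ μ' μ'' : V → ℝ, μ' ∈ M ∧ μ'' ∈ M ∧ μ' ≠ μ'' ∧
    ∃ α : ℝ, 0 < α ∧ α < 1 ∧ μ = fun v => α * μ' v + (1 - α) * μ'' v

open Filter Topology in
/-- A strict inequality between continuous functions at `0` persists near `0`. -/
lemma eventually_lt_of_lt_at_zero {f g : ℝ → ℝ} (hf : Continuous f) (hg : Continuous g)
    (h : f 0 < g 0) : ∀ᶠ t in 𝓝 (0 : ℝ), f t < g t :=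
  hf.continuousAt.eventually_lt hg.continuousAt h

/-- Feasible posteriors over a connected graph have full support. -/
lemma FeasibleSet.pos {V : Type*} [Fintype V] {G : SimpleGraph V} (hG : G.Connected)
    {ε : ℝ} {μ0 μ : V → ℝ} (hμ0 : ∀ v, 0 < μ0 v) (hμ : μ ∈ FeasibleSet G ε μ0) (v : V) :
    0 < μ v := by
  obtain ⟨⟨hnn, hsum⟩, hedge⟩ := hμ
  obtain ⟨u, -, hu⟩ : ∃ u ∈ (Finset.univ : Finset V), 0 < μ u := by
    apply Finset.exists_lt_of_sum_lt
    simp [hsum]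
  obtain ⟨p⟩ := hG.preconnected u v
  induction p with
  | nil => exact hu
  | cons h _ ih =>
    rename_i a b c _
    apply ih
    by_contra hb
    have hb0 : μ b = 0 := le_antisymm (not_lt.mp hb) (hnn b)
    have h1 := hedge a b h
    rw [hb0] at h1
    have h2 := mul_pos hu (hμ0 b)
    linarith

open Filter Topology in
/-- Perturbing a feasible posterior multiplicatively by a mean-zero direction that is constant
along tight edges preserves feasibility for small perturbations. -/
lemma FeasibleSet.eventually_perturb_mem {V : Type*} [Fintype V] {G : SimpleGraph V}
    {ε : ℝ} {μ0 μ : V → ℝ} (hμ : μ ∈ FeasibleSet G ε μ0) (hpos : ∀ v, 0 < μ v) {c : V → ℝ}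
    (hc : ∀ i j, G.Adj i j → μ i * μ0 j = Real.exp ε * (μ j * μ0 i) → c i = c j)
    (hmean : ∑ v, μ v * c v = 0) :
    ∀ᶠ t in 𝓝 (0 : ℝ), (fun v => μ v * (1 + t * c v)) ∈ FeasibleSet G ε μ0 := by
  obtain ⟨⟨-, hsum⟩, hedge⟩ := hμ
  have hone : ∀ v, ∀ᶠ t in 𝓝 (0 : ℝ), 0 < 1 + t * c v := fun v =>
    eventually_lt_of_lt_at_zero (f := fun _ => 0) (by fun_prop) (by fun_prop) (by simp)
  have hadj : ∀ i j, ∀ᶠ t in 𝓝 (0 : ℝ), G.Adj i j →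
      μ i * (1 + t * c i) * μ0 j ≤ Real.exp ε * (μ j * (1 + t * c j) * μ0 i) := by
    intro i j
    by_cases hij : G.Adj i j
    · by_cases hcij : c i = c j
      · filter_upwards [hone j] with t ht _
        rw [hcij]
        have := mul_le_mul_of_nonneg_right (hedge i j hij) ht.le
        linarith
      · have hlt : μ i * μ0 j < Real.exp ε * (μ j * μ0 i) :=
          lt_of_le_of_ne (hedge i j hij) fun h => hcij (hc i j hij h)
        have := eventually_lt_of_lt_at_zero
          (f := fun t => μ i * (1 + t * c i) * μ0 j)
          (g := fun t => Real.exp ε * (μ j * (1 + t * c j) * μ0 i))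
          (by fun_prop) (by fun_prop) (by simpa using hlt)
        filter_upwards [this] with t ht _ using ht.le
    · exact Eventually.of_forall fun _ h => absurd h hij
  filter_upwards [eventually_all.2 hone, eventually_all.2 fun i => eventually_all.2 (hadj i)]
    with t h1 h2
  refine ⟨⟨fun v => (mul_pos (hpos v) (h1 v)).le, ?_⟩, h2⟩
  have : ∑ v, μ v * (1 + t * c v) = ∑ v, μ v + t * ∑ v, μ v * c v := by
    rw [Finset.mul_sum, ← Finset.sum_add_distrib]
    exact Finset.sum_congr rfl fun v _ => by ring
  rw [this, hsum, hmean, mul_zero, add_zero]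

open Filter Topology in
/-- At an extreme point, every function that is constant along tight edges is constant. -/
lemma IsExtremePt.eq_of_tight {V : Type*} [Fintype V] {G : SimpleGraph V}
    {ε : ℝ} {μ0 μ : V → ℝ} (hext : IsExtremePt (FeasibleSet G ε μ0) μ) (hpos : ∀ v, 0 < μ v)
    {c : V → ℝ}
    (hc : ∀ i j, G.Adj i j → μ i * μ0 j = Real.exp ε * (μ j * μ0 i) → c i = c j) (i j : V) :
    c i = c j := by
  set m := ∑ v, μ v * c v with hm
  have hmean : ∑ v, μ v * (c v - m) = 0 := by
    simp only [mul_sub, Finset.sum_sub_distrib, ← Finset.sum_mul, hext.1.1.2]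
    rw [← hm]
    ring
  have hev := FeasibleSet.eventually_perturb_mem hext.1 hpos (c := fun v => c v - m)
    (fun i j hij h => by rw [hc i j hij h]) hmean
  have hneg := (continuous_neg.tendsto' (0 : ℝ) 0 neg_zero).eventually hev
  obtain ⟨t, ⟨h1, h2⟩, ht⟩ :=
    (((hev.and hneg).filter_mono nhdsWithin_le_nhds).and
      (self_mem_nhdsWithin : Set.Ioi (0 : ℝ) ∈ 𝓝[>] (0 : ℝ))).exists
  have ht : 0 < t := ht
  have hzero : ∀ v, c v = m := by
    by_contra! hne
    obtain ⟨v, hv⟩ := hne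
    refine hext.2 ⟨_, _, h1, h2, fun heq => ?_, 1 / 2, by norm_num, by norm_num, ?_⟩
    · have hv' := mul_left_cancel₀ (hpos v).ne' (congrFun heq v)
      have : t * (c v - m) = 0 := by linarith
      rcases mul_eq_zero.1 this with h | h
      · exact ht.ne' h
      · exact hv (sub_eq_zero.1 h)
    · funext w
      ring
  rw [hzero i, hzero j]

lemma assocW_add {V : Type*} (ε : ℝ) (μ0 μ : V → ℝ) (i j k : V) :
    assocW ε μ0 μ i j + assocW ε μ0 μ j k = assocW ε μ0 μ i k := by
  unfold assocW
  ring

lemma log_edge_eq {V : Type*} {ε : ℝ} {μ0 μ : V → ℝ} (hμ0 : ∀ v, 0 < μ0 v)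
    (hμ : ∀ v, 0 < μ v) (i j : V) :
    Real.log (Real.exp ε * (μ j * μ0 i)) - Real.log (μ i * μ0 j)
      = ε + (Real.log (μ j) - Real.log (μ0 j) - Real.log (μ i) + Real.log (μ0 i)) := by
  rw [Real.log_mul (Real.exp_pos ε).ne' (mul_pos (hμ j) (hμ0 i)).ne', Real.log_exp,
    Real.log_mul (hμ j).ne' (hμ0 i).ne', Real.log_mul (hμ i).ne' (hμ0 j).ne']
  ring

/-- A tight edge has weight `-1`. -/
lemma assocW_eq_neg_one {V : Type*} {ε : ℝ} (hε : 0 < ε) {μ0 μ : V → ℝ}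
    (hμ0 : ∀ v, 0 < μ0 v) (hμ : ∀ v, 0 < μ v) {i j : V}
    (h : μ i * μ0 j = Real.exp ε * (μ j * μ0 i)) : assocW ε μ0 μ i j = -1 := by
  have := log_edge_eq (ε := ε) hμ0 hμ i j
  rw [← h, sub_self] at this
  rw [assocW, div_eq_iff hε.ne']
  linarith

/-- The weight of an edge satisfying the privacy constraint is at least `-1`. -/
lemma neg_one_le_assocW {V : Type*} {ε : ℝ} (hε : 0 < ε) {μ0 μ : V → ℝ}
    (hμ0 : ∀ v, 0 < μ0 v) (hμ : ∀ v, 0 < μ v) {i j : V}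
    (h : μ i * μ0 j ≤ Real.exp ε * (μ j * μ0 i)) : -1 ≤ assocW ε μ0 μ i j := by
  have h1 := log_edge_eq (ε := ε) hμ0 hμ i j
  have h2 := Real.log_le_log (mul_pos (hμ i) (hμ0 j)) h
  rw [assocW, le_div_iff₀ hε]
  linarith

/-- Lemma: weights of extreme posteriors lie in `{−1, 0, 1}`.
If `μ ∈ M` is an extreme point of `M`, then `w_{ij} ∈ {−1, 0, 1}` for every edge
of `G`. -/
theorem stmt_2 {V : Type*} [Fintype V] [DecidableEq V]
    (hV : 2 ≤ Fintype.card V) (G : SimpleGraph V) (hG : G.Connected)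
    (ε : ℝ) (hε : 0 < ε) (μ0 : V → ℝ) (hμ0 : IsDist μ0) (hμ0pos : ∀ v, 0 < μ0 v)
    (μ : V → ℝ) (hμ : μ ∈ FeasibleSet G ε μ0)
    (hext : IsExtremePt (FeasibleSet G ε μ0) μ) :
    ∀ i j : V, G.Adj i j →
      assocW ε μ0 μ i j = -1 ∨ assocW ε μ0 μ i j = 0 ∨ assocW ε μ0 μ i j = 1 := by
  intro i j hij
  have hpos := FeasibleSet.pos hG hμ0pos hμ
  have hint : ∃ n : ℤ, assocW ε μ0 μ i j = n := by
    classical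
    have hconst := hext.eq_of_tight hpos
      (c := fun v => if ∃ n : ℤ, assocW ε μ0 μ i v = n then 1 else 0) (fun a b _ htight => by
        have hab := assocW_eq_neg_one hε hμ0pos hpos htight
        have hadd := assocW_add ε μ0 μ i a b
        have hiff : (∃ n : ℤ, assocW ε μ0 μ i a = n) ↔ ∃ n : ℤ, assocW ε μ0 μ i b = n := by
          constructor
          · rintro ⟨n, hn⟩
            exact ⟨n - 1, by push_cast; linarith⟩
          · rintro ⟨n, hn⟩
            exact ⟨n + 1, by push_cast; linarith⟩
        simp only [hiff]) i j
    have hi : ∃ n : ℤ, assocW ε μ0 μ i i = n := ⟨0, by simp [assocW]⟩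
    by_contra hj
    simp only [if_pos hi, if_neg hj] at hconst
    exact one_ne_zero hconst
  obtain ⟨n, hn⟩ := hint
  have hlow := neg_one_le_assocW hε hμ0pos hpos (hμ.2 i j hij)
  have hup := neg_one_le_assocW hε hμ0pos hpos (hμ.2 j i hij.symm)
  have hadd := assocW_add ε μ0 μ i j i
  have hii : assocW ε μ0 μ i i = 0 := by simp [assocW]
  have h1 : -1 ≤ n := by
    have : (-1 : ℝ) ≤ n := by linarith
    exact_mod_cast this
  have h2 : n ≤ 1 := by
    have : (n : ℝ) ≤ 1 := by linarith
    exact_mod_cast this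
  rw [hn]
  interval_cases n <;> simp
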